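/- Let f : {0,1}^n → {0,1} be a non-constant Boolean function. Then C_0(f) ≤ 2^{s_1(f)−1} · s_0(f) − (s_1(f) − 1). -/

import Mathlib

/-- The input `x` with its `i`-th coordinate flipped. -/
def flipCoord {n : ℕ} (x : Fin n → Bool) (i : Fin n) : Fin n → Bool :=
  Function.update x i (!(x i))

/-- The sensitivity `s(f, x)` of a Boolean function `f` on input `x`:
the number of coordinates whose flip changes the value of `f`. -/
def sensAt {n : ℕ} (f : (Fin n → Bool) → Bool) (x : Fin n → Bool) : ℕ :=
  (Finset.univ.filter fun i => f (flipCoord x i) ≠ f x).card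

/-- The `b`-sensitivity `s_b(f)`: the maximum of `s(f, x)` over inputs `x` with `f x = b`. -/
def bSens {n : ℕ} (f : (Fin n → Bool) → Bool) (b : Bool) : ℕ :=
  (Finset.univ.filter fun x => f x = b).sup (sensAt f)

/-- The certificate complexity `C(f, x)`: the minimum size of a set `P` of coordinates
such that fixing the coordinates in `P` to their values in `x` forces the value of `f`. -/
noncomputable def certAt {n : ℕ} (f : (Fin n → Bool) → Bool) (x : Fin n → Bool) : ℕ :=
  sInf {k | ∃ P : Finset (Fin n), P.card = k ∧
    ∀ y : Fin n → Bool, (∀ i ∈ P, y i = x i) → f y = f x}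

/-- The `b`-certificate complexity `C_b(f)`: the maximum of `C(f, x)` over `x` with `f x = b`. -/
noncomputable def bCert {n : ℕ} (f : (Fin n → Bool) → Bool) (b : Bool) : ℕ :=
  (Finset.univ.filter fun x => f x = b).sup (certAt f)

/-- A Boolean function is non-constant if it takes two different values. -/
def NonConstant {n : ℕ} (f : (Fin n → Bool) → Bool) : Prop :=
  ∃ x y, f x ≠ f y

section Flip

variable {n : ℕ}

theorem flipCoord_flipCoord (x : Fin n → Bool) (i : Fin n) :
    flipCoord (flipCoord x i) i = x := by
  simp [flipCoord]

theorem flipCoord_comm (x : Fin n → Bool) (i j : Fin n) :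
    flipCoord (flipCoord x i) j = flipCoord (flipCoord x j) i := by
  rcases eq_or_ne i j with rfl | h
  · rfl
  · simp only [flipCoord, Function.update_of_ne h, Function.update_of_ne h.symm]
    exact Function.update_comm h _ _ _

theorem flipCoord_cons_zero (b : Bool) (y : Fin n → Bool) :
    flipCoord (Fin.cons b y : Fin (n + 1) → Bool) 0 = Fin.cons (!b) y := by
  simp [flipCoord, Fin.update_cons_zero]

theorem flipCoord_cons_succ (b : Bool) (y : Fin n → Bool) (i : Fin n) :
    flipCoord (Fin.cons b y : Fin (n + 1) → Bool) i.succ = Fin.cons b (flipCoord y i) := by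
  simp [flipCoord, Fin.cons_update]

/-- The number of neighbours of `y` outside the set with indicator function `g`. -/
def outDegree (g : (Fin n → Bool) → Bool) (y : Fin n → Bool) : ℕ :=
  ∑ i, if g (flipCoord y i) then 0 else 1

/-- The number of neighbours of `y` inside the set with indicator function `g`. -/
def inDegree (g : (Fin n → Bool) → Bool) (y : Fin n → Bool) : ℕ :=
  ∑ i, if g (flipCoord y i) then 1 else 0

theorem sum_inDegree_eq_sum_outDegree (g : (Fin n → Bool) → Bool) :
    (∑ y, if g y then 0 else inDegree g y) = ∑ y, if g y then outDegree g y else 0 := by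
  have h₁ : ∀ y, (if g y then 0 else inDegree g y) =
      ∑ i, if g y = false ∧ g (flipCoord y i) = true then 1 else 0 := by
    intro y
    cases hy : g y <;> simp [inDegree]
  have h₂ : ∀ y, (if g y then outDegree g y else 0) =
      ∑ i, if g (flipCoord y i) = false ∧ g y = true then 1 else 0 := by
    intro y
    cases hy : g y
    · simp
    · simp only [outDegree, if_true, and_true]
      refine Finset.sum_congr rfl fun i _ => ?_
      cases g (flipCoord y i) <;> rfl
  simp only [h₁, h₂]
  rw [Finset.sum_comm, Finset.sum_comm (s := Finset.univ (α := Fin n → Bool))]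
  refine Finset.sum_congr rfl fun i _ => ?_
  let e : (Fin n → Bool) ≃ (Fin n → Bool) :=
    ⟨fun y => flipCoord y i, fun y => flipCoord y i,
      fun y => flipCoord_flipCoord y i, fun y => flipCoord_flipCoord y i⟩
  refine Fintype.sum_equiv e _ _ fun y => ?_
  simp [e, flipCoord_flipCoord]

theorem sum_cube_succ (F : (Fin (n + 1) → Bool) → ℕ) :
    ∑ y, F y = (∑ y : Fin n → Bool, F (Fin.cons false y)) +
      ∑ y : Fin n → Bool, F (Fin.cons true y) := by
  rw [← (Fin.consEquiv fun _ : Fin (n + 1) => Bool).sum_comp, Fintype.sum_prod_type,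
    Fintype.sum_bool, add_comm]
  rfl

theorem outDegree_cons (g : (Fin (n + 1) → Bool) → Bool) (b : Bool) (y : Fin n → Bool) :
    outDegree g (Fin.cons b y) = (if g (Fin.cons (!b) y) then 0 else 1) +
      outDegree (fun z => g (Fin.cons b z)) y := by
  simp only [outDegree, Fin.sum_univ_succ, flipCoord_cons_zero, flipCoord_cons_succ]

end Flip

/-- Simon's lemma, together with a linear lower bound for the edge boundary: a nonempty subset
of the cube all of whose points have at most `d` neighbours outside of it. -/
theorem card_and_boundary_lower_bound {n : ℕ} (g : (Fin n → Bool) → Bool) (d : ℕ)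
    (hne : ∃ y, g y = true) (hd : ∀ y, g y = true → outDegree g y ≤ d) :
    2 ^ n ≤ 2 ^ d * (∑ y, if g y then 1 else 0) ∧
      (d + 1) * 2 ^ n ≤
        2 ^ d * ((∑ y, if g y then outDegree g y else 0) + ∑ y, if g y then 1 else 0) := by
  induction n generalizing d with
  | zero =>
    obtain ⟨y, hy⟩ := hne
    have h : ∀ z, g z = true := fun z => Subsingleton.elim y z ▸ hy
    have := Nat.lt_two_pow_self (n := d)
    simp only [h, if_true, outDegree]
    simp
    omega
  | succ n ih =>
    have half : ∀ b : Bool, (∀ y, g (Fin.cons (!b) y) = false) →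
        2 ^ (n + 1) ≤ 2 ^ d * (∑ y : Fin n → Bool, if g (Fin.cons b y) then 1 else 0) ∧
        (d + 1) * 2 ^ (n + 1) ≤
          2 ^ d * ((∑ y : Fin n → Bool,
            if g (Fin.cons b y) then outDegree g (Fin.cons b y) else 0) +
            ∑ y : Fin n → Bool, if g (Fin.cons b y) then 1 else 0) := by
      intro b hb
      have hout : ∀ y, outDegree g (Fin.cons b y) =
          1 + outDegree (fun z => g (Fin.cons b z)) y := by
        intro y
        simp [outDegree_cons, hb]
      have hne' : ∃ y : Fin n → Bool, g (Fin.cons b y) = true := by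
        obtain ⟨y, hy⟩ := hne
        rw [← Fin.cons_self_tail y] at hy
        refine ⟨Fin.tail y, ?_⟩
        rcases Bool.eq_or_eq_not (y 0) b with h | h
        · rwa [h] at hy
        · rw [h, hb] at hy
          cases hy
      obtain ⟨w, hw⟩ := hne'
      obtain ⟨d, rfl⟩ : ∃ e, d = e + 1 := by
        have := hd _ hw
        rw [hout] at this
        exact ⟨d - 1, by omega⟩
      obtain ⟨h₁, h₂⟩ := ih (fun z => g (Fin.cons b z)) d ⟨w, hw⟩ fun y hy => by
        have := hd _ hy
        rw [hout] at this
        omega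
      have hsum : (∑ y : Fin n → Bool,
          if g (Fin.cons b y) then outDegree g (Fin.cons b y) else 0) =
          (∑ y : Fin n → Bool, if g (Fin.cons b y) then 1 else 0) +
          ∑ y : Fin n → Bool,
            if g (Fin.cons b y) then outDegree (fun z => g (Fin.cons b z)) y else 0 := by
        rw [← Finset.sum_add_distrib]
        refine Finset.sum_congr rfl fun y _ => ?_
        rw [hout]
        split <;> rfl
      rw [hsum]
      simp only [pow_succ]
      constructor <;> nlinarith
    rw [sum_cube_succ, sum_cube_succ]
    by_cases h₀ : ∃ y, g (Fin.cons false y) = true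
    · by_cases h₁ : ∃ y, g (Fin.cons true y) = true
      · have part : ∀ b : Bool, (∃ y, g (Fin.cons b y) = true) →
            2 ^ n ≤ 2 ^ d * (∑ y : Fin n → Bool, if g (Fin.cons b y) then 1 else 0) ∧
            (d + 1) * 2 ^ n ≤
              2 ^ d * ((∑ y : Fin n → Bool,
                if g (Fin.cons b y) then outDegree g (Fin.cons b y) else 0) +
                ∑ y : Fin n → Bool, if g (Fin.cons b y) then 1 else 0) := by
          intro b hb
          have hle : ∀ y, outDegree (fun z => g (Fin.cons b z)) y ≤
              outDegree g (Fin.cons b y) := by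
            intro y
            rw [outDegree_cons]
            exact Nat.le_add_left _ _
          obtain ⟨k₁, k₂⟩ := ih (fun z => g (Fin.cons b z)) d hb
            fun y hy => (hle y).trans (hd _ hy)
          refine ⟨k₁, k₂.trans ?_⟩
          gcongr 2 ^ d * (?_ + _)
          refine Finset.sum_le_sum fun y _ => ?_
          split
          · exact hle y
          · exact le_rfl
        obtain ⟨a₁, a₂⟩ := part false h₀
        obtain ⟨b₁, b₂⟩ := part true h₁
        rw [pow_succ]
        constructor <;> nlinarith
      · have hf : ∀ y, g (Fin.cons true y) = false := by simpa using h₁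
        simpa [hf] using half false hf
    · have hf : ∀ y, g (Fin.cons false y) = false := by simpa using h₀
      simpa [hf] using half true hf

theorem sensAt_eq_sum {n : ℕ} (f : (Fin n → Bool) → Bool) (x : Fin n → Bool) :
    sensAt f x = ∑ i, if f (flipCoord x i) = f x then 0 else 1 := by
  simp [sensAt, Finset.card_filter]

theorem sensAt_le_bSens {n : ℕ} (f : (Fin n → Bool) → Bool) {x : Fin n → Bool} {b : Bool}
    (hx : f x = b) : sensAt f x ≤ bSens f b :=
  Finset.le_sup (f := sensAt f) (by simpa using hx)

section Certificate

variable {n : ℕ}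

/-- The input `y` with its coordinates in `P` replaced by those of `x`. -/
def overwrite (P : Finset (Fin n)) (x y : Fin n → Bool) : Fin n → Bool :=
  fun i => if i ∈ P then x i else y i

theorem overwrite_flipCoord_of_mem {P : Finset (Fin n)} (x y : Fin n → Bool) {l : Fin n}
    (hl : l ∈ P) : overwrite P x (flipCoord y l) = overwrite P x y := by
  funext i
  by_cases hi : i ∈ P
  · simp [overwrite, hi]
  · have : i ≠ l := fun h => hi (h ▸ hl)
    simp [overwrite, hi, flipCoord, this]

theorem overwrite_flipCoord_of_notMem {P : Finset (Fin n)} (x y : Fin n → Bool) {l : Fin n}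
    (hl : l ∉ P) : overwrite P x (flipCoord y l) = flipCoord (overwrite P x y) l := by
  funext i
  rcases eq_or_ne i l with rfl | h
  · simp [overwrite, hl, flipCoord]
  · simp [overwrite, flipCoord, h]

/-- The restriction of `f` to the subcube given by `x` on `P` with the `i`-th coordinate flipped,
as a function on the whole cube. -/
def sideSlice (f : (Fin n → Bool) → Bool) (P : Finset (Fin n)) (x : Fin n → Bool) (i : Fin n)
    (y : Fin n → Bool) : Bool :=
  f (flipCoord (overwrite P x y) i)

theorem sideSlice_flipCoord_of_mem (f : (Fin n → Bool) → Bool) {P : Finset (Fin n)}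
    (x y : Fin n → Bool) (i : Fin n) {l : Fin n} (hl : l ∈ P) :
    sideSlice f P x i (flipCoord y l) = sideSlice f P x i y := by
  rw [sideSlice, overwrite_flipCoord_of_mem x y hl, sideSlice]

theorem sideSlice_flipCoord_of_notMem (f : (Fin n → Bool) → Bool) {P : Finset (Fin n)}
    (x y : Fin n → Bool) (i : Fin n) {l : Fin n} (hl : l ∉ P) :
    sideSlice f P x i (flipCoord y l) =
      f (flipCoord (flipCoord (overwrite P x y) i) l) := by
  rw [sideSlice, overwrite_flipCoord_of_notMem x y hl, flipCoord_comm]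

variable {f : (Fin n → Bool) → Bool} {P : Finset (Fin n)} {x : Fin n → Bool}

theorem apply_overwrite (hP : ∀ y, (∀ i ∈ P, y i = x i) → f y = false) (y : Fin n → Bool) :
    f (overwrite P x y) = false :=
  hP _ fun i hi => by simp [overwrite, hi]

theorem sum_sideSlice_le (hP : ∀ y, (∀ i ∈ P, y i = x i) → f y = false) (y : Fin n → Bool) :
    (∑ i ∈ P, if sideSlice f P x i y then 1 else 0) ≤ bSens f false := by
  refine le_trans ?_ (sensAt_le_bSens f (apply_overwrite hP y))
  rw [sensAt_eq_sum, apply_overwrite hP y]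
  refine le_trans (Finset.sum_le_sum fun i _ => ?_)
    (Finset.sum_le_sum_of_subset (Finset.subset_univ P))
  rw [sideSlice]
  cases f (flipCoord (overwrite P x y) i) <;> simp

/-- A `1`-input on a side of the subcube is sensitive to the direction of the subcube. -/
theorem outDegree_sideSlice_add_le (hP : ∀ y, (∀ i ∈ P, y i = x i) → f y = false)
    {i : Fin n} (hi : i ∈ P) {y : Fin n → Bool} (hy : sideSlice f P x i y = true) :
    outDegree (sideSlice f P x i) y + 1 + (∑ j ∈ P.erase i,
      if f (flipCoord (flipCoord (overwrite P x y) i) j) then 0 else 1) ≤ bSens f true := by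
  refine le_trans (le_of_eq ?_) (sensAt_le_bSens f hy)
  have hy' : f (flipCoord (overwrite P x y) i) = true := hy
  rw [sensAt_eq_sum, ← Finset.sum_add_sum_compl P, outDegree, ← Finset.sum_add_sum_compl P,
    Finset.sum_eq_zero (s := P), ← Finset.add_sum_erase P _ hi, flipCoord_flipCoord,
    apply_overwrite hP y, hy']
  · have : ∀ l ∈ Pᶜ, (if sideSlice f P x i (flipCoord y l) then 0 else 1) =
        if f (flipCoord (flipCoord (overwrite P x y) i) l) = true then 0 else 1 := by
      intro l hl
      rw [sideSlice_flipCoord_of_notMem f x y i (by simpa using hl)]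
    rw [Finset.sum_congr rfl this]
    simp
    ring
  · intro l hl
    rw [sideSlice_flipCoord_of_mem f x y i hl, hy]
    rfl

theorem inDegree_sideSlice_add_le {i : Fin n} {y : Fin n → Bool}
    (hy : sideSlice f P x i y = false) :
    inDegree (sideSlice f P x i) y + (∑ j ∈ P.erase i,
      if f (flipCoord (flipCoord (overwrite P x y) i) j) then 1 else 0) ≤ bSens f false := by
  refine le_trans ?_ (sensAt_le_bSens f hy)
  have hy' : f (flipCoord (overwrite P x y) i) = false := hy
  rw [sensAt_eq_sum, ← Finset.sum_add_sum_compl P, inDegree, ← Finset.sum_add_sum_compl P,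
    Finset.sum_eq_zero (s := P), zero_add, add_comm, hy']
  · refine add_le_add (le_trans (Finset.sum_le_sum fun j _ => ?_)
      (Finset.sum_le_sum_of_subset (Finset.erase_subset i P))) (Finset.sum_le_sum fun l hl => ?_)
    · cases f (flipCoord (flipCoord (overwrite P x y) i) j) <;> simp
    · rw [sideSlice_flipCoord_of_notMem f x y i (by simpa using hl)]
      cases f (flipCoord (flipCoord (overwrite P x y) i) l) <;> simp
  · intro l hl
    rw [sideSlice_flipCoord_of_mem f x y i hl, hy]
    rfl

theorem pointwise_count (hP : ∀ y, (∀ i ∈ P, y i = x i) → f y = false) {d : ℕ}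
    (hd : bSens f true = d + 1) (y : Fin n → Bool) :
    P.card * (∑ i ∈ P, if sideSlice f P x i y then 1 else 0) +
      (∑ i ∈ P, if sideSlice f P x i y then 0 else inDegree (sideSlice f P x i) y) +
      (∑ i ∈ P, if sideSlice f P x i y then outDegree (sideSlice f P x i) y else 0) ≤
    P.card * bSens f false + d * ∑ i ∈ P, if sideSlice f P x i y then 1 else 0 := by
  set N := ∑ i ∈ P, if sideSlice f P x i y then 1 else 0 with hN
  let z : Fin n → Fin n → ℕ := fun i j =>
    if f (flipCoord (flipCoord (overwrite P x y) i) j) then 0 else 1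
  have hin : ∀ i ∈ P, N + (if sideSlice f P x i y then 0 else inDegree (sideSlice f P x i) y) ≤
      bSens f false + ∑ j ∈ P.erase i, if sideSlice f P x j y then z i j else 0 := by
    intro i hi
    cases hy : sideSlice f P x i y
    · have h := inDegree_sideSlice_add_le hy
      have hN' : N ≤ (∑ j ∈ P.erase i,
          if f (flipCoord (flipCoord (overwrite P x y) i) j) then 1 else 0) +
          ∑ j ∈ P.erase i, if sideSlice f P x j y then z i j else 0 := by
        rw [hN, ← Finset.add_sum_erase P _ hi, hy, ← Finset.sum_add_distrib]
        simp only [Bool.false_eq_true, if_false, zero_add]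
        refine Finset.sum_le_sum fun j _ => ?_
        simp only [z]
        cases sideSlice f P x j y <;>
          cases f (flipCoord (flipCoord (overwrite P x y) i) j) <;> simp
      simp only [Bool.false_eq_true, if_false]
      omega
    · simp only [if_true, add_zero]
      exact (sum_sideSlice_le hP y).trans (Nat.le_add_right _ _)
  have hout : ∀ j ∈ P, (if sideSlice f P x j y then outDegree (sideSlice f P x j) y else 0) +
      (∑ i ∈ P.erase j, if sideSlice f P x j y then z i j else 0) ≤
      d * if sideSlice f P x j y then 1 else 0 := by
    intro j hj
    cases hy : sideSlice f P x j y
    · simp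
    · have h := outDegree_sideSlice_add_le hP hj hy
      simp only [flipCoord_comm (overwrite P x y) j] at h
      simp only [if_true, z]
      omega
  have hswap : (∑ i ∈ P, ∑ j ∈ P.erase i, if sideSlice f P x j y then z i j else 0) =
      ∑ j ∈ P, ∑ i ∈ P.erase j, if sideSlice f P x j y then z i j else 0 :=
    Finset.sum_comm' fun i j => by
      simp only [Finset.mem_erase, ne_eq]
      tauto
  have h₁ := Finset.sum_le_sum hin
  have h₂ := Finset.sum_le_sum hout
  simp only [Finset.sum_add_distrib, Finset.sum_const, smul_eq_mul, ← Finset.mul_sum, ← hN] at h₁ h₂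
  omega

/-- Removing a coordinate from a minimum certificate leaves no certificate. -/
theorem exists_sideSlice (hP : ∀ y, (∀ i ∈ P, y i = x i) → f y = false) (hx : f x = false)
    (hcard : P.card = certAt f x) {i : Fin n} (hi : i ∈ P) : ∃ y, sideSlice f P x i y = true := by
  by_contra! h
  simp only [ne_eq, Bool.not_eq_true] at h
  have hle : certAt f x ≤ (P.erase i).card := by
    refine Nat.sInf_le ⟨P.erase i, rfl, fun y hy => ?_⟩
    rw [hx]
    by_cases hyi : y i = x i
    · refine hP y fun j hj => ?_
      rcases eq_or_ne j i with rfl | hji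
      · exact hyi
      · exact hy j (Finset.mem_erase.2 ⟨hji, hj⟩)
    · rw [← h y, sideSlice]
      congr 1
      funext j
      rcases eq_or_ne j i with rfl | hji
      · simpa [flipCoord, overwrite, hi] using Bool.eq_not.2 hyi
      · by_cases hj : j ∈ P
        · simpa [flipCoord, overwrite, hj, hji] using hy j (Finset.mem_erase.2 ⟨hji, hj⟩)
        · simp [flipCoord, overwrite, hj, hji]
  have := Finset.card_erase_lt_of_mem hi
  omega

end Certificate

theorem exists_certificate {n : ℕ} (f : (Fin n → Bool) → Bool) (x : Fin n → Bool) :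
    ∃ P : Finset (Fin n), P.card = certAt f x ∧
      ∀ y : Fin n → Bool, (∀ i ∈ P, y i = x i) → f y = f x :=
  Nat.sInf_mem (s := {k | ∃ P : Finset (Fin n), P.card = k ∧
    ∀ y : Fin n → Bool, (∀ i ∈ P, y i = x i) → f y = f x})
    ⟨_, Finset.univ, rfl, fun _ hy => congrArg f (funext fun i => hy i (Finset.mem_univ i))⟩

theorem add_le_of_counts {m d S K a b : ℕ} (hK : 0 < K) (hS : 2 ^ d ≤ S)
    (h : m * a + 2 * b ≤ m * S * K + d * a) (ha : a ≤ S * K) (hm : m * K ≤ a)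
    (hb : m * (d + 1) * K ≤ b + a) : m + d ≤ S := by
  rcases le_or_gt m d with hmd | hmd
  · refine le_trans ?_ hS
    rcases d with _ | d
    · omega
    · have := Nat.lt_two_pow_self (n := d)
      rw [pow_succ]
      omega
  · obtain ⟨e, rfl⟩ := Nat.exists_eq_add_of_lt hmd
    rcases e with _ | e
    · by_contra! hlt
      have hS' : S ≤ 2 * d := by omega
      have h₁ : 2 * ((d + 1) * (d + 1) * K) ≤ (d + 2) * (S * K) := by nlinarith
      have h₂ : (d + 2) * (S * K) ≤ (d + 2) * (2 * d * K) := by gcongr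
      nlinarith
    · have h₁ : (d + e + 2) * ((d + e + 2 + d) * K) ≤ (d + e + 2) * (S * K) := by
        have h₂ : e * ((d + e + 2) * K) ≤ e * a :=
          Nat.mul_le_mul_left e (by linarith)
        nlinarith
      have h₂ := Nat.le_of_mul_le_mul_left h₁ (by omega)
      have h₃ := Nat.le_of_mul_le_mul_right h₂ hK
      omega

theorem certAt_add_le {n : ℕ} {f : (Fin n → Bool) → Bool} {d : ℕ}
    (hd : bSens f true = d + 1) (h₀ : 1 ≤ bSens f false) {x : Fin n → Bool} (hx : f x = false) :
    certAt f x + d ≤ 2 ^ d * bSens f false := by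
  obtain ⟨P, hcard, hP⟩ := exists_certificate f x
  rw [hx] at hP
  rw [← hcard]
  let a : ℕ := ∑ i ∈ P, ∑ y, if sideSlice f P x i y then 1 else 0
  let b : ℕ := ∑ i ∈ P, ∑ y, if sideSlice f P x i y then outDegree (sideSlice f P x i) y else 0
  have hcube : Fintype.card (Fin n → Bool) = 2 ^ n := by simp
  have hbound : ∀ i ∈ P, _ := fun i hi =>
    card_and_boundary_lower_bound (sideSlice f P x i) d (exists_sideSlice hP hx hcard hi)
      fun y hy => by
        have := outDegree_sideSlice_add_le hP hi hy
        omega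
  have hm : P.card * 2 ^ n ≤ 2 ^ d * a := by
    have := Finset.sum_le_sum fun i hi => (hbound i hi).1
    simpa only [Finset.sum_const, smul_eq_mul, ← Finset.mul_sum] using this
  have hb : P.card * (d + 1) * 2 ^ n ≤ 2 ^ d * b + 2 ^ d * a := by
    have := Finset.sum_le_sum fun i hi => (hbound i hi).2
    simp only [Finset.sum_const, smul_eq_mul, ← Finset.mul_sum, Finset.sum_add_distrib] at this
    rwa [mul_assoc, ← mul_add]
  have ha : a ≤ 2 ^ n * bSens f false := by
    have := Finset.sum_le_sum fun y (_ : y ∈ Finset.univ) => sum_sideSlice_le hP y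
    rw [Finset.sum_comm] at this
    simpa only [Finset.sum_const, smul_eq_mul, Finset.card_univ, hcube] using this
  have hab : P.card * a + b + b ≤ 2 ^ n * (P.card * bSens f false) + d * a := by
    have := Finset.sum_le_sum fun y (_ : y ∈ Finset.univ) => pointwise_count hP hd y
    simp only [Finset.sum_add_distrib, ← Finset.mul_sum, Finset.sum_const, smul_eq_mul,
      Finset.card_univ, hcube] at this
    simp only [Finset.sum_comm (s := Finset.univ) (t := P), sum_inDegree_eq_sum_outDegree] at this
    rwa [mul_left_comm]
  refine add_le_of_counts (K := 2 ^ n) (a := 2 ^ d * a) (b := 2 ^ d * b) (by positivity)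
    (Nat.le_mul_of_pos_right _ h₀) ?_ ?_ hm hb
  · have := Nat.mul_le_mul_left (2 ^ d) hab
    linarith
  · have := Nat.mul_le_mul_left (2 ^ d) ha
    linarith

theorem NonConstant.exists_flipCoord_ne {n : ℕ} {f : (Fin n → Bool) → Bool}
    (hf : NonConstant f) : ∃ x i, f (flipCoord x i) ≠ f x := by
  by_contra! h
  obtain ⟨x, y, hxy⟩ := hf
  have key : ∀ P : Finset (Fin n), f (overwrite P x y) = f y := by
    intro P
    induction P using Finset.induction_on with
    | empty => rfl
    | insert i P hi ih =>
      rw [← ih]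
      by_cases hxyi : x i = y i
      · congr 1
        funext j
        rcases eq_or_ne j i with rfl | hj
        · simp [overwrite, hi, hxyi]
        · simp [overwrite, hj]
      · rw [← h (overwrite P x y) i]
        congr 1
        funext j
        rcases eq_or_ne j i with rfl | hj
        · simpa [overwrite, flipCoord, hi] using Bool.eq_not.2 hxyi
        · simp [overwrite, flipCoord, hj]
  exact hxy ((congrArg f (funext fun i => by simp [overwrite])).trans (key Finset.univ))

theorem NonConstant.one_le_bSens {n : ℕ} {f : (Fin n → Bool) → Bool}
    (hf : NonConstant f) (b : Bool) : 1 ≤ bSens f b := by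
  obtain ⟨x, i, hxi⟩ := hf.exists_flipCoord_ne
  have hpos : ∀ y, f (flipCoord y i) ≠ f y → 1 ≤ sensAt f y := fun y hy =>
    Finset.card_pos.2 ⟨i, by simpa using hy⟩
  by_cases hb : f x = b
  · exact (hpos x hxi).trans (sensAt_le_bSens f hb)
  · refine (hpos (flipCoord x i) ?_).trans (sensAt_le_bSens f (x := flipCoord x i) ?_)
    · rw [flipCoord_flipCoord]
      exact hxi.symm
    · rw [Bool.eq_not.2 hxi, Bool.eq_not.2 hb, Bool.not_not]

/-- **Prior bound (Ambainis et al.).** For non-constant `f`,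
`C₀(f) ≤ 2^(s₁(f)-1) · s₀(f) − (s₁(f) − 1)`. -/
theorem cert0_le_prior_bound {n : ℕ} (f : (Fin n → Bool) → Bool)
    (hnc : NonConstant f) :
    (bCert f false : ℚ) ≤
      2 ^ (bSens f true - 1) * (bSens f false : ℚ) - ((bSens f true : ℚ) - 1) := by
  obtain ⟨d, hd⟩ := Nat.exists_eq_add_of_le' (hnc.one_le_bSens true)
  have h₀ := hnc.one_le_bSens false
  have hS : d ≤ 2 ^ d * bSens f false :=
    Nat.lt_two_pow_self.le.trans (Nat.le_mul_of_pos_right _ h₀)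
  have hle : bCert f false ≤ 2 ^ d * bSens f false - d :=
    Finset.sup_le fun x hx =>
      Nat.le_sub_of_add_le (certAt_add_le hd h₀ (Finset.mem_filter.1 hx).2)
  have hmain : bCert f false + d ≤ 2 ^ d * bSens f false := by omega
  have hcast : (bCert f false : ℚ) + d ≤ 2 ^ d * bSens f false := by exact_mod_cast hmain
  rw [hd]
  rw [Nat.add_sub_cancel]
  push_cast
  linarith
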